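/- Let n ≥ 2 and let Λ = ℤ[i]e_1 + Σ_{j=2}^{n} ℤ[i](1/(1−i))(e_{j-1} − e_j) ⊆ ℂⁿ (a G(4,1,n)-invariant ℤ-lattice of full rank 2n). Then the affine reflection group W = G(4,1,n) ⋉ Λ has the Steinberg property: every point of ℂⁿ fixed by some non-identity element of W lies on a reflecting hyperplane of W. -/

import Mathlib

open Matrix Complex

noncomputable section

/-- `ℤ[ζ] = ℤ + ℤζ` as a subset of `ℂ`. -/
def Zlat (ζ : ℂ) : Set ℂ := {z | ∃ a b : ℤ, z = (a : ℂ) + (b : ℂ) * ζ}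

/-- Membership in the complex reflection group `G(r,p,n)`: monomial matrices whose
nonzero entries are `r`-th roots of unity and whose product of nonzero entries,
raised to the power `r / p`, equals `1`. -/
def IsGrpn (r p n : ℕ) (M : Matrix (Fin n) (Fin n) ℂ) : Prop :=
  (∀ i, ∃! j, M i j ≠ 0) ∧ (∀ j, ∃! i, M i j ≠ 0) ∧
  (∀ i j, M i j ≠ 0 → M i j ^ r = 1) ∧
  (∏ i, ∑ j, M i j) ^ (r / p) = 1

/-- The affine transformation `v ↦ M v + t` encoded by the pair `g = (M, t)`. -/
def applyAff {n : ℕ} (g : Matrix (Fin n) (Fin n) ℂ × (Fin n → ℂ)) (v : Fin n → ℂ) :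
    Fin n → ℂ :=
  g.1.mulVec v + g.2

/-- An affine hyperplane in `ℂⁿ`: the solution set of a nonzero affine-linear equation. -/
def IsAffineHyperplane {n : ℕ} (H : Set (Fin n → ℂ)) : Prop :=
  ∃ a : Fin n → ℂ, a ≠ 0 ∧ ∃ c : ℂ, H = {v | ∑ i, a i * v i = c}

/-- A reflecting hyperplane of `W`: an affine hyperplane fixed pointwise by some
non-identity element of `W`. -/
def IsReflectingHyperplane {n : ℕ}
    (W : Matrix (Fin n) (Fin n) ℂ × (Fin n → ℂ) → Prop) (H : Set (Fin n → ℂ)) : Prop :=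
  IsAffineHyperplane H ∧
  ∃ g, W g ∧ (∃ v, applyAff g v ≠ v) ∧ ∀ v ∈ H, applyAff g v = v

/-- `W` has the Steinberg property: every point fixed by some non-identity element
of `W` lies on a reflecting hyperplane of `W`. -/
def SteinbergProperty {n : ℕ}
    (W : Matrix (Fin n) (Fin n) ℂ × (Fin n → ℂ) → Prop) : Prop :=
  ∀ u : Fin n → ℂ,
    (∃ g, W g ∧ (∃ v, applyAff g v ≠ v) ∧ applyAff g u = u) →
    ∃ H, IsReflectingHyperplane W H ∧ u ∈ H

/-- `stdGen n 0 = e₁` and, for `j ≥ 1` (0-indexed), `stdGen n j = e_{j-1} - e_j`. -/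
def stdGen (n : ℕ) (j : Fin n) : Fin n → ℂ := fun i =>
  if i = j then (if (j : ℕ) = 0 then 1 else -1)
  else if (i : ℕ) + 1 = (j : ℕ) then 1 else 0

/-- `genB n ξ 0 = ξ e₁ - e₂` and, for `j ≥ 1` (0-indexed), `genB n ξ j = e_{j-1} - e_j`. -/
def genB (n : ℕ) (ξ : ℂ) (j : Fin n) : Fin n → ℂ :=
  if (j : ℕ) = 0 then
    (fun i => if (i : ℕ) = 0 then ξ else if (i : ℕ) = 1 then -1 else 0)
  else stdGen n j

/-- The Gaussian integers as a subring of `ℂ`. -/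
def gaussianSubring : Subring ℂ := GaussianInt.toComplex.range

lemma mem_gaussianSubring {z : ℂ} :
    z ∈ gaussianSubring ↔ ∃ a b : ℤ, z = (a : ℂ) + (b : ℂ) * I := by
  constructor
  · rintro ⟨w, rfl⟩
    exact ⟨w.re, w.im, GaussianInt.toComplex_def w⟩
  · rintro ⟨a, b, rfl⟩
    exact ⟨⟨a, b⟩, GaussianInt.toComplex_def' a b⟩

lemma I_mem_gaussianSubring : I ∈ gaussianSubring :=
  mem_gaussianSubring.2 ⟨0, 1, by simp⟩

lemma one_sub_I_ne_zero : (1 : ℂ) - I ≠ 0 := fun h => by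
  simpa using congrArg Complex.re h

lemma eq_of_pow_four_eq_one {ζ : ℂ} (h : ζ ^ 4 = 1) :
    ζ = 1 ∨ ζ = -1 ∨ ζ = I ∨ ζ = -I := by
  have h' : (ζ - 1) * ((ζ + 1) * ((ζ - I) * (ζ + I))) = 0 := by
    linear_combination h - (ζ ^ 2 - 1) * I_sq
  rcases mul_eq_zero.1 h' with h | h
  · exact Or.inl (sub_eq_zero.1 h)
  rcases mul_eq_zero.1 h with h | h
  · exact Or.inr (Or.inl (eq_neg_of_add_eq_zero_left h))
  rcases mul_eq_zero.1 h with h | h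
  · exact Or.inr (Or.inr (Or.inl (sub_eq_zero.1 h)))
  · exact Or.inr (Or.inr (Or.inr (eq_neg_of_add_eq_zero_left h)))

lemma mem_gaussianSubring_of_pow_four_eq_one {ζ : ℂ} (h : ζ ^ 4 = 1) :
    ζ ∈ gaussianSubring := by
  rcases eq_of_pow_four_eq_one h with rfl | rfl | rfl | rfl
  · exact one_mem _
  · exact neg_mem (one_mem _)
  · exact I_mem_gaussianSubring
  · exact neg_mem I_mem_gaussianSubring

/-- `1 - ζ` is a multiple of `1 - i` for every fourth root of unity `ζ`. -/
lemma one_sub_mul_mem_gaussianSubring {ζ c : ℂ} (h : ζ ^ 4 = 1)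
    (hc : (1 - I) * c ∈ gaussianSubring) : (1 - ζ) * c ∈ gaussianSubring := by
  rcases eq_of_pow_four_eq_one h with rfl | rfl | rfl | rfl
  · simp
  · have := mul_mem (add_mem (one_mem _) I_mem_gaussianSubring) hc
    convert this using 1
    linear_combination c * I_sq
  · exact hc
  · convert mul_mem I_mem_gaussianSubring hc using 1
    linear_combination c * I_sq

/-- Two Gaussian integers not divisible by `1 - i` are congruent modulo `2` up to a unit. -/
lemma exists_unit_half_sub_mem {s t : ℂ}
    (hs : (1 - I) * s ∈ gaussianSubring) (ht : (1 - I) * t ∈ gaussianSubring)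
    (hs' : s ∉ gaussianSubring) (ht' : t ∉ gaussianSubring) :
    ∃ ζ : ℂ, ζ ^ 4 = 1 ∧ (1 - I) * (s / 2 - ζ * (t / 2)) ∈ gaussianSubring := by
  have odd_add {w : ℂ} {a b : ℤ} (hw' : w ∉ gaussianSubring)
      (h : (1 - I) * w = a + b * I) : (a + b) % 2 = 1 := by
    by_contra hab
    obtain ⟨m, hm⟩ : ∃ m, a = 2 * m - b := ⟨(a + b) / 2, by omega⟩
    refine hw' (mem_gaussianSubring.2 ⟨m - b, m, ?_⟩)
    apply mul_left_cancel₀ one_sub_I_ne_zero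
    rw [h, hm]
    push_cast
    linear_combination (m : ℂ) * I_sq
  obtain ⟨a, b, hab⟩ := mem_gaussianSubring.1 hs
  obtain ⟨c, d, hcd⟩ := mem_gaussianSubring.1 ht
  have h₁ := odd_add hs' hab
  have h₂ := odd_add ht' hcd
  by_cases hac : (a - c) % 2 = 0
  · obtain ⟨m, hm⟩ : ∃ m, a = c + 2 * m := ⟨(a - c) / 2, by omega⟩
    obtain ⟨k, hk⟩ : ∃ k, b = d + 2 * k := ⟨(b - d) / 2, by omega⟩
    refine ⟨1, by norm_num, mem_gaussianSubring.2 ⟨m, k, ?_⟩⟩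
    rw [hm, hk] at hab
    push_cast at hab
    linear_combination hab / 2 - hcd / 2
  · obtain ⟨m, hm⟩ : ∃ m, a = -d + 2 * m := ⟨(a + d) / 2, by omega⟩
    obtain ⟨k, hk⟩ : ∃ k, b = c + 2 * k := ⟨(b - c) / 2, by omega⟩
    refine ⟨I, I_pow_four, mem_gaussianSubring.2 ⟨m, k, ?_⟩⟩
    rw [hm, hk] at hab
    push_cast at hab
    linear_combination hab / 2 - I * hcd / 2 - (d / 2 : ℂ) * I_sq

lemma sum_stdGen {n : ℕ} (j : Fin n) :
    ∑ i, stdGen n j i = if (j : ℕ) = 0 then 1 else 0 := by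
  have key (i : Fin n) : stdGen n j i =
      (if i = j then (if (j : ℕ) = 0 then 1 else -1) else 0) +
        (if (i : ℕ) + 1 = j then 1 else 0) := by
    unfold stdGen
    split_ifs with h <;> first | omega | simp
  simp_rw [key, Finset.sum_add_distrib]
  rw [Finset.sum_ite_eq' Finset.univ j]
  simp only [Finset.mem_univ, if_true]
  split_ifs with h0
  · rw [Finset.sum_eq_zero, add_zero]
    intro i _
    rw [if_neg (by omega)]
  · rw [Finset.sum_eq_single (⟨j - 1, by omega⟩ : Fin n)]
    · rw [if_pos (by simp only []; omega)]
      norm_num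
    · intro i _ hi
      rw [if_neg]
      intro h
      exact hi (Fin.ext (by simp only []; omega))
    · simp

lemma stdGen_mem_gaussianSubring {n : ℕ} (j i : Fin n) : stdGen n j i ∈ gaussianSubring := by
  unfold stdGen
  split_ifs
  · exact one_mem _
  · exact neg_mem (one_mem _)
  · exact one_mem _
  · exact zero_mem _

/-- The lattice generated by `e₁` and the `(1 / (1 - i)) (e_{j-1} - e_j)`. -/
def gaussianLattice (n : ℕ) : Set (Fin n → ℂ) :=
  {v | ∃ c : Fin n → ℂ, (∀ j, c j ∈ Zlat Complex.I) ∧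
      v = ∑ j, c j • (if (j : ℕ) = 0 then stdGen n j
        else (1 / (1 - Complex.I)) • stdGen n j)}

lemma mul_mem_and_sum_mem_of_mem_gaussianLattice {n : ℕ} {v : Fin n → ℂ}
    (hv : v ∈ gaussianLattice n) :
    (∀ i, (1 - I) * v i ∈ gaussianSubring) ∧ ∑ i, v i ∈ gaussianSubring := by
  obtain ⟨c, hc, rfl⟩ := hv
  have hc' (j) : c j ∈ gaussianSubring := mem_gaussianSubring.2 (hc j)
  constructor
  · intro i
    rw [Finset.sum_apply, Finset.mul_sum]
    refine sum_mem fun j _ => ?_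
    have h := mul_mem (hc' j) (stdGen_mem_gaussianSubring j i)
    split_ifs
    · exact mul_mem (sub_mem (one_mem _) I_mem_gaussianSubring) h
    · convert h using 1
      simp only [Pi.smul_apply, smul_eq_mul]
      field_simp [one_sub_I_ne_zero]
  · simp_rw [Finset.sum_apply]
    rw [Finset.sum_comm]
    refine sum_mem fun j _ => ?_
    simp_rw [Pi.smul_apply, smul_eq_mul]
    rw [← Finset.mul_sum]
    refine mul_mem (hc' j) ?_
    have h := sum_stdGen j
    split_ifs at h ⊢
    · rw [h]
      exact one_mem _
    · simp_rw [Pi.smul_apply, smul_eq_mul]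
      rw [← Finset.mul_sum, h, mul_zero]
      exact zero_mem _

lemma mem_gaussianLattice_of_mul_mem_of_sum_mem {n : ℕ} {v : Fin n → ℂ}
    (hv : ∀ i, (1 - I) * v i ∈ gaussianSubring) (hs : ∑ i, v i ∈ gaussianSubring) :
    v ∈ gaussianLattice n := by
  let S : ℕ → ℂ := fun m => ∑ i : Fin n, if m ≤ i then v i else 0
  have hS0 : S 0 = ∑ i, v i := by simp [S]
  have hSn (m : ℕ) (hm : n ≤ m) : S m = 0 :=
    Finset.sum_eq_zero fun i _ => if_neg (by omega)
  have hSucc (i : Fin n) : S i = v i + S (i + 1) := by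
    have h : v i = ∑ k : Fin n, if k = i then v k else 0 := by simp
    rw [h]
    simp only [S]
    rw [← Finset.sum_add_distrib]
    refine Finset.sum_congr rfl fun k _ => ?_
    split_ifs <;> first | omega | simp
  have hSmem (m : ℕ) : (1 - I) * S m ∈ gaussianSubring := by
    rw [Finset.mul_sum]
    refine sum_mem fun i _ => ?_
    split_ifs
    · exact hv i
    · simp
  refine ⟨fun j => if (j : ℕ) = 0 then S 0 else -((1 - I) * S j), fun j => ?_, ?_⟩
  · refine mem_gaussianSubring.1 ?_
    dsimp only
    split_ifs
    · exact hS0 ▸ hs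
    · exact neg_mem (hSmem j)
  · ext i
    have key (j : Fin n) : ((if (j : ℕ) = 0 then S 0 else -((1 - I) * S j)) •
        (if (j : ℕ) = 0 then stdGen n j else (1 / (1 - I)) • stdGen n j)) i =
        (if i = j then S j else 0) - (if (i : ℕ) + 1 = j then S j else 0) := by
      have := one_sub_I_ne_zero
      by_cases h0 : (j : ℕ) = 0
      · simp [h0, stdGen]
      · simp only [h0, if_false, Pi.smul_apply, smul_eq_mul, stdGen]
        split_ifs <;> first | omega | (field_simp; try ring)
    rw [Finset.sum_apply]
    simp_rw [key]
    rw [Finset.sum_sub_distrib, Finset.sum_ite_eq Finset.univ i]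
    simp only [Finset.mem_univ, if_true]
    have hsum : (∑ j : Fin n, if (i : ℕ) + 1 = j then S j else 0) = S (i + 1) := by
      by_cases hi : (i : ℕ) + 1 < n
      · rw [Finset.sum_eq_single (⟨i + 1, hi⟩ : Fin n)]
        · simp
        · intro j _ hj
          exact if_neg fun h => hj (Fin.ext h.symm)
        · simp
      · rw [hSn _ (by omega)]
        exact Finset.sum_eq_zero fun j _ => if_neg (by omega)
    rw [hsum, hSucc i]
    ring

/-- The monomial matrix sending `v` to `i ↦ d i * v (σ i)`. -/
def monomialMatrix {n : ℕ} (σ : Equiv.Perm (Fin n)) (d : Fin n → ℂ) :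
    Matrix (Fin n) (Fin n) ℂ :=
  Matrix.of fun i j => if j = σ i then d i else 0

lemma monomialMatrix_mulVec {n : ℕ} (σ : Equiv.Perm (Fin n)) (d v : Fin n → ℂ) (i : Fin n) :
    (monomialMatrix σ d).mulVec v i = d i * v (σ i) := by
  simp [monomialMatrix, Matrix.mulVec, dotProduct]

lemma isGrpn_monomialMatrix {n : ℕ} (σ : Equiv.Perm (Fin n)) {d : Fin n → ℂ}
    (hd : ∀ i, d i ^ 4 = 1) : IsGrpn 4 1 n (monomialMatrix σ d) := by
  have hd0 (i) : d i ≠ 0 := fun h => by simpa [h] using hd i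
  refine ⟨fun i => ⟨σ i, ?_, fun j hj => ?_⟩, fun j => ⟨σ.symm j, ?_, fun i hi => ?_⟩,
    fun i j h => ?_, ?_⟩
  · simpa [monomialMatrix] using hd0 i
  · by_contra h
    simp [monomialMatrix, h] at hj
  · simpa [monomialMatrix] using hd0 _
  · rw [Equiv.eq_symm_apply]
    by_contra h
    simp [monomialMatrix, Ne.symm h] at hi
  · by_cases hj : j = σ i
    · simpa [monomialMatrix, hj] using hd i
    · simp [monomialMatrix, hj] at h
  · simp [monomialMatrix, ← Finset.prod_pow, hd]

/-- A point with `2 u_k ∈ ℤ[i]` lies on the mirror of a diagonal reflection. -/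
lemma exists_diagonal_reflection {n : ℕ} {u : Fin n → ℂ} {k : Fin n}
    (h : 2 * u k ∈ gaussianSubring) :
    ∃ H, IsReflectingHyperplane (fun g => IsGrpn 4 1 n g.1 ∧ g.2 ∈ gaussianLattice n) H ∧
      u ∈ H := by
  refine ⟨{v | ∑ i, (Pi.single k 1 : Fin n → ℂ) i * v i = u k},
    ⟨⟨Pi.single k 1, by simp, u k, rfl⟩,
      (monomialMatrix 1 (Function.update 1 k (-1)), Pi.single k (2 * u k)),
      ⟨isGrpn_monomialMatrix _ fun i => ?_, ?_⟩, ⟨Pi.single k (u k + 1), fun hv => ?_⟩,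
      fun v hv => ?_⟩, ?_⟩
  · by_cases hi : i = k
    · subst hi
      norm_num
    · simp [hi]
  · refine mem_gaussianLattice_of_mul_mem_of_sum_mem (fun i => ?_) ?_
    · refine mul_mem (sub_mem (one_mem _) I_mem_gaussianSubring) ?_
      by_cases hi : i = k
      · subst hi
        simpa using h
      · simp [hi]
    · simpa using h
  · have := congrFun hv k
    simp only [applyAff, Pi.add_apply, monomialMatrix_mulVec, Function.update_self,
      Equiv.Perm.coe_one, id, Pi.single_eq_same] at this
    have h2 : (2 : ℂ) = 0 := by linear_combination -this
    norm_num at h2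
  · have hv' : v k = u k := by simpa [Pi.single_apply] using hv
    ext i
    simp only [applyAff, Pi.add_apply, monomialMatrix_mulVec, Equiv.Perm.coe_one, id]
    by_cases hi : i = k
    · subst hi
      simp [hv']
      ring
    · simp [hi]
  · simp [Pi.single_apply]

/-- A point with `u_j - ζ u_k ∈ (1 - i)⁻¹ ℤ[i]` lies on the mirror of a twisted transposition. -/
lemma exists_transposition_reflection {n : ℕ} {u : Fin n → ℂ} {j k : Fin n} (hjk : j ≠ k)
    {ζ : ℂ} (hζ : ζ ^ 4 = 1) (h : (1 - I) * (u j - ζ * u k) ∈ gaussianSubring) :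
    ∃ H, IsReflectingHyperplane (fun g => IsGrpn 4 1 n g.1 ∧ g.2 ∈ gaussianLattice n) H ∧
      u ∈ H := by
  have hkj := hjk.symm
  have hζ0 : ζ ≠ 0 := fun h => by simp [h] at hζ
  have hζ' : ζ⁻¹ ^ 4 = 1 := by rw [inv_pow, hζ, inv_one]
  let a : Fin n → ℂ := Pi.single j 1 - Pi.single k ζ
  have ha : a ≠ 0 := fun h0 => by simpa [a, hjk] using congrFun h0 j
  have hsum (v : Fin n → ℂ) : ∑ i, a i * v i = v j - ζ * v k := by
    simp [a, sub_mul, Pi.single_apply, Finset.sum_sub_distrib]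
  obtain ⟨c, hc⟩ : ∃ c, u j - ζ * u k = c := ⟨_, rfl⟩
  rw [hc] at h
  let d : Fin n → ℂ := fun i => if i = k then ζ⁻¹ else if i = j then ζ else 1
  let t : Fin n → ℂ := Pi.single j c - Pi.single k (ζ⁻¹ * c)
  have hdj : d j = ζ := by simp [d, hjk]
  have hdk : d k = ζ⁻¹ := by simp [d]
  have htj : t j = c := by simp [t, hjk]
  have htk : t k = -(ζ⁻¹ * c) := by simp [t, hkj]
  have hd' {i} (hi : i ≠ k) (hi' : i ≠ j) : d i = 1 := by simp [d, hi, hi']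
  have ht' {i} (hi : i ≠ k) (hi' : i ≠ j) : t i = 0 := by simp [t, hi, hi']
  refine ⟨{v | ∑ i, a i * v i = c},
    ⟨⟨a, ha, c, rfl⟩,
      (monomialMatrix (Equiv.swap j k) d, t),
      ⟨isGrpn_monomialMatrix _ fun i => ?_, ?_⟩, ⟨Pi.single j (c + 1), fun hv => ?_⟩,
      fun v hv => ?_⟩, (hsum u).trans hc⟩
  · dsimp only [d]
    split_ifs
    · exact hζ'
    · exact hζ
    · exact one_pow 4
  · refine mem_gaussianLattice_of_mul_mem_of_sum_mem (fun i => ?_) ?_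
    · change (1 - I) * t i ∈ gaussianSubring
      by_cases hi : i = k
      · rw [hi, htk]
        have := neg_mem (mul_mem (mem_gaussianSubring_of_pow_four_eq_one hζ') h)
        convert this using 1
        ring
      · by_cases hi' : i = j
        · rwa [hi', htj]
        · rw [ht' hi hi', mul_zero]
          exact zero_mem _
    · convert one_sub_mul_mem_gaussianSubring hζ' h using 1
      simp [t, Finset.sum_sub_distrib]
      ring
  · have := congrFun hv j
    simp only [applyAff, Pi.add_apply, monomialMatrix_mulVec, Equiv.swap_apply_left, htj,
      Pi.single_eq_same, Pi.single_eq_of_ne hkj] at this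
    simp at this
  · have hv' : v j - ζ * v k = c := (hsum v).symm.trans hv
    ext i
    simp only [applyAff, Pi.add_apply, monomialMatrix_mulVec]
    by_cases hi : i = k
    · rw [hi, Equiv.swap_apply_right, hdk, htk, ← hv']
      field_simp
      ring
    · by_cases hi' : i = j
      · rw [hi', Equiv.swap_apply_left, hdj, htj, ← hv']
        ring
      · rw [Equiv.swap_apply_of_ne_of_ne hi' hi, hd' hi hi', ht' hi hi']
        ring

/-- Steinberg's theorem for `[G(4,1,n)]₂` with lattice
`Λ = ℤ[i]e₁ + Σ_{j=2}^n ℤ[i](1/(1-i))(e_{j-1} - e_j)`. -/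
theorem steinberg_G_4_1_n_lattice2 (n : ℕ) (hn : 2 ≤ n)
    (Λ : Set (Fin n → ℂ))
    (hΛ : Λ = {v | ∃ c : Fin n → ℂ, (∀ j, c j ∈ Zlat Complex.I) ∧
      v = ∑ j, c j • (if (j : ℕ) = 0 then stdGen n j
        else (1 / (1 - Complex.I)) • stdGen n j)}) :
    SteinbergProperty (fun g => IsGrpn 4 1 n g.1 ∧ g.2 ∈ Λ) := by
  change Λ = gaussianLattice n at hΛ
  subst hΛ
  rintro u ⟨⟨M, t⟩, ⟨⟨hrow, -, hroot, -⟩, ht⟩, ⟨v, hv⟩, hu⟩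
  dsimp only at hrow hroot ht
  obtain ⟨htc, hts⟩ := mul_mem_and_sum_mem_of_mem_gaussianLattice ht
  have mulVec_row {i j : Fin n} (hij : M i j ≠ 0) (w : Fin n → ℂ) :
      M.mulVec w i = M i j * w j := by
    refine Finset.sum_eq_single j (fun l _ hl => ?_)
      fun h => absurd (Finset.mem_univ j) h
    have : M i l = 0 := by
      by_contra h
      exact hl ((hrow i).unique h hij)
    exact mul_eq_zero_of_left this _
  have hfix {i j : Fin n} (hij : M i j ≠ 0) : M i j * u j + t i = u i := by
    rw [← mulVec_row hij u]
    exact congrFun hu i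
  by_cases hoff : ∃ i j, i ≠ j ∧ M i j ≠ 0
  · obtain ⟨i, j, hij, hM⟩ := hoff
    refine exists_transposition_reflection hij (hroot i j hM) ?_
    rw [← hfix hM, add_sub_cancel_left]
    exact htc i
  push Not at hoff
  have hdiag (i : Fin n) : M i i ≠ 0 := by
    obtain ⟨j, hj, -⟩ := hrow i
    by_cases hij : i = j
    · exact hij ▸ hj
    · exact absurd (hoff i j hij) hj
  have hti (i : Fin n) : t i = (1 - M i i) * u i := by
    linear_combination hfix (hdiag i)
  obtain ⟨k, hk⟩ : ∃ k, M k k ≠ 1 := by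
    by_contra! h
    refine hv (funext fun i => ?_)
    change M.mulVec v i + t i = v i
    rw [mulVec_row (hdiag i), hti, h]
    ring
  by_contra hno
  have hnot (i : Fin n) : 2 * u i ∉ gaussianSubring := fun h =>
    hno (exists_diagonal_reflection h)
  have hsign (i : Fin n) : M i i = 1 ∨ M i i = -1 := by
    rcases eq_of_pow_four_eq_one (hroot i i (hdiag i)) with h | h | h | h
    · exact Or.inl h
    · exact Or.inr h
    · refine absurd ?_ (hnot i)
      convert mul_mem I_mem_gaussianSubring (htc i) using 1
      rw [hti, h]
      linear_combination (2 * u i - I * u i) * I_sq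
    · refine absurd ?_ (hnot i)
      convert htc i using 1
      rw [hti, h]
      linear_combination u i * I_sq
  have htwo {i : Fin n} (h : M i i ≠ 1) : t i = 2 * u i := by
    rw [hti, (hsign i).resolve_left h]
    ring
  obtain ⟨j, hjk, hj⟩ : ∃ j, j ≠ k ∧ M j j ≠ 1 := by
    by_contra! h
    have hsum : ∑ i, t i = t k :=
      Finset.sum_eq_single k (fun i _ hi => by rw [hti, h i hi]; ring) (by simp)
    rw [hsum, htwo hk] at hts
    exact hnot k hts
  have htj := htwo hj
  have htk := htwo hk
  obtain ⟨ζ, hζ, hmem⟩ := exists_unit_half_sub_mem (htc j) (htc k)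
    (htj ▸ hnot j) (htk ▸ hnot k)
  refine hno (exists_transposition_reflection hjk hζ ?_)
  rwa [htj, htk, mul_div_cancel_left₀ _ two_ne_zero, mul_div_cancel_left₀ _ two_ne_zero] at hmem
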